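/- arXiv:2501.10032 — 4 statements merged into one kernel-verified Lean document; each statement's English description precedes it below -/
import Mathlib

section
/- Let 𝒳 be a simple family in the composite space V indexed by a finite set I, and let J' ⊆ J ⊆ I. Then δ_{E_{J,J'}}(t) = O(π̃_{𝒳,J}(t)); that is, there is a constant C > 0 with δ_{E_{J,J'}}(t) ≤ C·π̃_{𝒳,J}(t) for all t ≥ 1. -/
/-- The data of a simple family in the composite space `⊔_{i ∈ I} ℝ^{m i}`
parameterized by `ℝ^n`: for each index `i` the defining linear polynomials
`f i 1, …, f i (m i)` and whether the component family is a family of points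
(`isPoint i = true`) or a family of half-lines (`isPoint i = false`, in which
case `m i ≥ 1`). -/
structure SimpleFam (I : Type) (m : I → ℕ) (n : ℕ) where
  f : ∀ i : I, Fin (m i) → ((Fin n → ℝ) →ₗ[ℝ] ℝ)
  isPoint : I → Bool
  pos : ∀ i, isPoint i = false → 0 < m i

/-- The component of the member at parameter `b` in the space `ℝ^{m i}`:
either the point `(f i 1 b, …, f i (m i) b)`, or the half-line
`{(f i 1 b, …, f i (m i − 1) b, t) : t ≥ f i (m i) b}`. -/
def SimpleFam.sec {I : Type} {m : I → ℕ} {n : ℕ} (𝒳 : SimpleFam I m n)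
    (i : I) (b : Fin n → ℝ) : Set (Fin (m i) → ℝ) :=
  if 𝒳.isPoint i then {x | ∀ k, x k = 𝒳.f i k b}
  else {x | ∀ k : Fin (m i), ((k : ℕ) + 1 < m i → x k = 𝒳.f i k b) ∧
    ((k : ℕ) + 1 = m i → 𝒳.f i k b ≤ x k)}

/-- The member of the simple family at parameter `b`, as a subset of the
composite space `Σ i, ℝ^{m i}`. -/
def SimpleFam.mem {I : Type} {m : I → ℕ} {n : ℕ} (𝒳 : SimpleFam I m n)
    (b : Fin n → ℝ) : Set (Σ i : I, Fin (m i) → ℝ) :=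
  {q | q.2 ∈ 𝒳.sec q.1 b}

/-- A parameter `b` is critical with respect to `(A, J, J')`:
`X b [i] ∩ A ≠ ∅` for every `i ∈ J`, and for `i ∈ J`,
`(f i 1 b, …, f i (m i) b) ∈ A` iff `i ∈ J'`. -/
def SimpleFam.Critical {I : Type} {m : I → ℕ} {n : ℕ} (𝒳 : SimpleFam I m n)
    (A : Set (Σ i : I, Fin (m i) → ℝ)) (J J' : Set I) (b : Fin n → ℝ) : Prop :=
  (∀ i ∈ J, ∃ v ∈ 𝒳.sec i b, (⟨i, v⟩ : Σ i : I, Fin (m i) → ℝ) ∈ A) ∧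
  (∀ i ∈ J, ((⟨i, fun k => 𝒳.f i k b⟩ : Σ i : I, Fin (m i) → ℝ) ∈ A ↔ i ∈ J'))

/-- The dimension of the grid coordinate at `i`: `m i` if `i ∈ J'`, and
`m i − 1` if `i ∈ J ∖ J'`. -/
def gdim {I : Type} [DecidableEq I] (m : I → ℕ) (J' : Finset I) (i : I) : ℕ :=
  if i ∈ J' then m i else m i - 1

/-- Realizing a grid coordinate as a point of `ℝ^{m i}`: for `i ∈ J'` this is
the point itself, for `i ∉ J'` the point `(x, α)` whose last coordinate is `α`. -/
def toFull {I : Type} [DecidableEq I] (m : I → ℕ) (J' : Finset I) (i : I)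
    (x : Fin (gdim m J' i) → ℝ) (α : ℝ) : Fin (m i) → ℝ :=
  fun k => if h : (k : ℕ) < gdim m J' i then x ⟨k, h⟩ else α

/-- The point set `P(x̄, α) ⊆ V[J]`. -/
def gridPointSet {I : Type} [DecidableEq I] {m : I → ℕ} (J J' : Finset I)
    (x : ∀ i : J, Fin (gdim m J' i.1) → ℝ) (α : ℝ) :
    Set (Σ i : I, Fin (m i) → ℝ) :=
  {q | ∃ h : q.1 ∈ J, q.2 = toFull m J' q.1 (x ⟨q.1, h⟩) α}

/-- The set `E_{J,J'}` of grid points `x̄` admitting `α ∈ ℝ` and a parameter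
`b` critical with respect to `(P(x̄, α), J, J')`. -/
def Ecrit {I : Type} [DecidableEq I] {m : I → ℕ} {n : ℕ} (𝒳 : SimpleFam I m n)
    (J J' : Finset I) : Set (∀ i : J, Fin (gdim m J' i.1) → ℝ) :=
  {x | ∃ (α : ℝ) (b : Fin n → ℝ), 𝒳.Critical (gridPointSet J J' x α) ↑J ↑J' b}

/-- The extremal function `δ_E(t)`: the maximum of `|E ∩ W|` over finite
sub-grids `W = ∏_{i ∈ J} W i` with `Σ_{i ∈ J} |W i| = t`. -/
noncomputable def gridDelta {I : Type} [DecidableEq I] {m : I → ℕ} (J J' : Finset I)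
    (E : Set (∀ i : J, Fin (gdim m J' i.1) → ℝ)) (t : ℕ) : ℕ :=
  sSup {N : ℕ | ∃ W : ∀ i : J, Finset (Fin (gdim m J' i.1) → ℝ),
    (∑ i, (W i).card) = t ∧ N = Set.ncard (E ∩ {x | ∀ i, x i ∈ W i})}

/-- The `J`-forced shatter function. -/
noncomputable def forcedShatter {I : Type} {V : I → Type} {β : Type}
    (X : β → Set (Σ i, V i)) (J : Set I) (t : ℕ) : ℕ :=
  sSup {N : ℕ | ∃ A : Finset (Σ i, V i), A.card = t ∧
    N = Set.ncard {T : Set (Σ i, V i) | ∃ b, T = X b ∩ ↑A ∧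
      ∀ i ∈ J, ∃ v : V i, (⟨i, v⟩ : Σ i, V i) ∈ X b ∩ ↑A}}

theorem SimpleFam.vertex_mem_sec {I : Type} {m : I → ℕ} {n : ℕ} (𝒳 : SimpleFam I m n)
    (i : I) (b : Fin n → ℝ) : (fun k => 𝒳.f i k b) ∈ 𝒳.sec i b := by
  unfold SimpleFam.sec
  split <;> simp

/-- Two members whose components contain each other's vertices have the same vertex. -/
theorem SimpleFam.vertex_eq_of_mem_sec {I : Type} {m : I → ℕ} {n : ℕ} (𝒳 : SimpleFam I m n)
    {i : I} {b c : Fin n → ℝ} (hb : (fun k => 𝒳.f i k b) ∈ 𝒳.sec i c)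
    (hc : (fun k => 𝒳.f i k c) ∈ 𝒳.sec i b) :
    (fun k => 𝒳.f i k b) = fun k => 𝒳.f i k c := by
  unfold SimpleFam.sec at hb hc
  funext k
  split at hb
  · exact hb k
  · rename_i h
    rw [if_neg h] at hc
    rcases Nat.lt_or_ge ((k : ℕ) + 1) (m i) with hk | hk
    · exact (hb k).1 hk
    · have hk' : (k : ℕ) + 1 = m i := by omega
      exact le_antisymm ((hc k).2 hk') ((hb k).2 hk')

theorem SimpleFam.eq_of_mem_sec {I : Type} {m : I → ℕ} {n : ℕ} (𝒳 : SimpleFam I m n)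
    {i : I} {b : Fin n → ℝ} {v : Fin (m i) → ℝ} (hv : v ∈ 𝒳.sec i b) {k : Fin (m i)}
    (hk : (k : ℕ) + 1 < m i) : v k = 𝒳.f i k b := by
  unfold SimpleFam.sec at hv
  split at hv
  · exact hv k
  · exact (hv k).1 hk

theorem gdim_le {I : Type} [DecidableEq I] (m : I → ℕ) (J' : Finset I) (i : I) :
    gdim m J' i ≤ m i := by
  unfold gdim
  split <;> omega

theorem toFull_apply_castLE {I : Type} [DecidableEq I] {m : I → ℕ} {J' : Finset I} {i : I}
    (x : Fin (gdim m J' i) → ℝ) (α : ℝ) (k : Fin (gdim m J' i)) :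
    toFull m J' i x α (k.castLE (gdim_le m J' i)) = x k := by
  simp [toFull]

theorem toFull_injective {I : Type} [DecidableEq I] (m : I → ℕ) (J' : Finset I) (i : I)
    (α : ℝ) : Function.Injective fun x => toFull m J' i x α := by
  intro x y h
  funext k
  simpa only [toFull_apply_castLE] using congrFun h (k.castLE (gdim_le m J' i))

theorem toFull_eq_of_mem {I : Type} [DecidableEq I] {m : I → ℕ} {J' : Finset I} {i : I}
    (hi : i ∈ J') (x : Fin (gdim m J' i) → ℝ) (α β : ℝ) :
    toFull m J' i x α = toFull m J' i x β := by
  funext k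
  have : (k : ℕ) < gdim m J' i := by simp [gdim, hi]
  simp [toFull, this]

/-- Away from `J'`, a component contains at most one grid point at a given height. -/
theorem SimpleFam.toFull_unique {I : Type} [DecidableEq I] {m : I → ℕ} {n : ℕ}
    (𝒳 : SimpleFam I m n) {J' : Finset I} {i : I} (hi : i ∉ J') {b : Fin n → ℝ}
    {x y : Fin (gdim m J' i) → ℝ} {α : ℝ} (hx : toFull m J' i x α ∈ 𝒳.sec i b)
    (hy : toFull m J' i y α ∈ 𝒳.sec i b) : x = y := by
  funext k
  have hk : ((k.castLE (gdim_le m J' i) : Fin (m i)) : ℕ) + 1 < m i := by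
    have h1 : (k : ℕ) < gdim m J' i := k.2
    have h2 : gdim m J' i = m i - 1 := by simp [gdim, hi]
    rw [Fin.val_castLE]
    omega
  rw [← toFull_apply_castLE x α k, ← toFull_apply_castLE y α k,
    𝒳.eq_of_mem_sec hx hk, 𝒳.eq_of_mem_sec hy hk]

/-- Raising the last coordinate of a point of a half-line stays in the half-line. -/
theorem SimpleFam.toFull_mem_sec_mono {I : Type} [DecidableEq I] {m : I → ℕ} {n : ℕ}
    (𝒳 : SimpleFam I m n) {J' : Finset I} {i : I} (hi : i ∉ J')
    (hp : 𝒳.isPoint i = false) {b : Fin n → ℝ} {x : Fin (gdim m J' i) → ℝ} {α β : ℝ}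
    (hαβ : α ≤ β) (hx : toFull m J' i x α ∈ 𝒳.sec i b) :
    toFull m J' i x β ∈ 𝒳.sec i b := by
  have hg : gdim m J' i = m i - 1 := by simp [gdim, hi]
  simp only [SimpleFam.sec, hp, Bool.false_eq_true, if_false, Set.mem_ofPred_eq] at hx ⊢
  intro k
  refine ⟨fun hk => ?_, fun hk => ?_⟩
  · have hlt : (k : ℕ) < gdim m J' i := by omega
    have := (hx k).1 hk
    simpa [toFull, hlt] using this
  · have hlt : ¬ (k : ℕ) < gdim m J' i := by omega
    have := (hx k).2 hk
    simp only [toFull, hlt, dite_false] at this ⊢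
    exact this.trans hαβ

/-- Every grid point of `E_{J,J'}` is realized, by a single parameter, at all large heights. -/
theorem SimpleFam.exists_of_mem_Ecrit {I : Type} [DecidableEq I] {m : I → ℕ} {n : ℕ}
    (𝒳 : SimpleFam I m n) {J J' : Finset I} {x : ∀ i : J, Fin (gdim m J' i.1) → ℝ}
    (hx : x ∈ Ecrit 𝒳 J J') :
    ∃ (α : ℝ) (b : Fin n → ℝ), ∀ β, α ≤ β → ∀ i : J,
      toFull m J' i.1 (x i) β ∈ 𝒳.sec i.1 b ∧
      (i.1 ∈ J' → toFull m J' i.1 (x i) β = fun k => 𝒳.f i.1 k b) := by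
  obtain ⟨α, b, hmeet, hvert⟩ := hx
  refine ⟨α, b, fun β hβ i => ?_⟩
  by_cases hi : i.1 ∈ J'
  · obtain ⟨_, h⟩ := (hvert i.1 i.2).2 hi
    have h' : toFull m J' i.1 (x i) β = fun k => 𝒳.f i.1 k b := by
      rw [toFull_eq_of_mem hi (x i) β α]
      exact h.symm
    exact ⟨h' ▸ 𝒳.vertex_mem_sec i.1 b, fun _ => h'⟩
  · obtain ⟨v, hv, _, hvx⟩ := hmeet i.1 i.2
    dsimp only at hvx
    have hp : 𝒳.isPoint i.1 = false := by
      by_contra hp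
      have hv' : v = fun k => 𝒳.f i.1 k b := by
        rw [SimpleFam.sec, if_pos (by simpa using hp)] at hv
        exact funext hv
      exact hi ((hvert i.1 i.2).1 ⟨i.2, by rw [← hvx, hv']⟩)
    rw [hvx] at hv
    exact ⟨𝒳.toFull_mem_sec_mono hi hp hβ hv, fun h => absurd h hi⟩

/-- The traces on `A` counted by the `J`-forced shatter function. -/
def forcedTraces {I : Type} {V : I → Type} {β : Type}
    (X : β → Set (Σ i, V i)) (J : Set I) (A : Finset (Σ i, V i)) : Set (Set (Σ i, V i)) :=
  {T | ∃ b, T = X b ∩ ↑A ∧ ∀ i ∈ J, ∃ v : V i, (⟨i, v⟩ : Σ i, V i) ∈ X b ∩ ↑A}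

theorem forcedTraces_subset_powerset {I : Type} {V : I → Type} {β : Type}
    (X : β → Set (Σ i, V i)) (J : Set I) (A : Finset (Σ i, V i)) :
    forcedTraces X J A ⊆ 𝒫 (A : Set (Σ i, V i)) := by
  rintro T ⟨b, rfl, -⟩
  exact Set.inter_subset_right

theorem ncard_forcedTraces_le {I : Type} {V : I → Type} {β : Type}
    (X : β → Set (Σ i, V i)) (J : Set I) (A : Finset (Σ i, V i)) :
    (forcedTraces X J A).ncard ≤ forcedShatter X J A.card := by
  refine le_csSup ⟨2 ^ A.card, ?_⟩ ⟨A, rfl, rfl⟩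
  rintro N ⟨B, hB, rfl⟩
  calc _ ≤ (𝒫 (B : Set (Σ i, V i))).ncard :=
        Set.ncard_le_ncard (forcedTraces_subset_powerset X J B) B.finite_toSet.finite_subsets
    _ = 2 ^ A.card := by rw [Set.ncard_powerset _ B.finite_toSet, Set.ncard_coe_finset, hB]

/-- The point set in the composite space obtained by realizing the sides of the sub-grid `W`
at height `α`. -/
noncomputable def gridRealization {I : Type} [DecidableEq I] {m : I → ℕ} {J J' : Finset I}
    (W : ∀ i : J, Finset (Fin (gdim m J' i.1) → ℝ)) (α : ℝ) :
    Finset (Σ i : I, Fin (m i) → ℝ) :=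
  (Finset.univ.sigma W).map
    ⟨fun p => ⟨p.1.1, toFull m J' p.1.1 p.2 α⟩, by
      rintro ⟨⟨i, hi⟩, x⟩ ⟨⟨j, hj⟩, y⟩ h
      obtain ⟨rfl, h⟩ := Sigma.mk.inj h
      obtain rfl : x = y := toFull_injective m J' i α (eq_of_heq h)
      rfl⟩

theorem card_gridRealization {I : Type} [DecidableEq I] {m : I → ℕ} {J J' : Finset I}
    (W : ∀ i : J, Finset (Fin (gdim m J' i.1) → ℝ)) (α : ℝ) :
    (gridRealization W α).card = ∑ i, (W i).card := by
  rw [gridRealization, Finset.card_map, Finset.card_sigma]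

theorem mem_gridRealization {I : Type} [DecidableEq I] {m : I → ℕ} {J J' : Finset I}
    {W : ∀ i : J, Finset (Fin (gdim m J' i.1) → ℝ)} (α : ℝ) {i : J}
    {x : Fin (gdim m J' i.1) → ℝ} (hx : x ∈ W i) :
    (⟨i.1, toFull m J' i.1 x α⟩ : Σ i : I, Fin (m i) → ℝ) ∈ gridRealization W α :=
  Finset.mem_map.2 ⟨⟨i, x⟩, Finset.mem_sigma.2 ⟨Finset.mem_univ _, hx⟩, rfl⟩

/-- Distinct points of `E_{J,J'}` in a sub-grid yield distinct forced traces. -/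
theorem SimpleFam.ncard_Ecrit_inter_le {I : Type} [DecidableEq I] {m : I → ℕ} {n : ℕ}
    (𝒳 : SimpleFam I m n) (J J' : Finset I)
    (W : ∀ i : J, Finset (Fin (gdim m J' i.1) → ℝ)) :
    (Ecrit 𝒳 J J' ∩ {x | ∀ i, x i ∈ W i}).ncard ≤
      forcedShatter 𝒳.mem ↑J (∑ i, (W i).card) := by
  have hfin : (Ecrit 𝒳 J J' ∩ {x | ∀ i, x i ∈ W i}).Finite :=
    (Set.Finite.pi' fun i => (W i).finite_toSet).subset fun x hx => hx.2
  choose! height param hparam using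
    fun x (hx : x ∈ Ecrit 𝒳 J J') => 𝒳.exists_of_mem_Ecrit hx
  obtain ⟨α, hα⟩ := (hfin.image height).bddAbove
  have key : ∀ x ∈ Ecrit 𝒳 J J' ∩ {x | ∀ i, x i ∈ W i}, ∀ i : J,
      toFull m J' i.1 (x i) α ∈ 𝒳.sec i.1 (param x) ∧
      (i.1 ∈ J' → toFull m J' i.1 (x i) α = fun k => 𝒳.f i.1 k (param x)) :=
    fun x hx => hparam x hx.1 α (hα (Set.mem_image_of_mem _ hx))
  have transfer : ∀ x ∈ Ecrit 𝒳 J J' ∩ {x | ∀ i, x i ∈ W i}, ∀ c : Fin n → ℝ,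
      𝒳.mem (param x) ∩ ↑(gridRealization W α) = 𝒳.mem c ∩ ↑(gridRealization W α) →
      ∀ i : J, toFull m J' i.1 (x i) α ∈ 𝒳.sec i.1 c := by
    intro x hx c h i
    exact (h.subset ⟨(key x hx i).1, mem_gridRealization α (hx.2 i)⟩).1
  rw [← card_gridRealization W α]
  refine le_trans ?_ (ncard_forcedTraces_le 𝒳.mem ↑J (gridRealization W α))
  refine Set.ncard_le_ncard_of_injOn
    (fun x => 𝒳.mem (param x) ∩ ↑(gridRealization W α)) ?_ ?_
    ((gridRealization W α).finite_toSet.finite_subsets.subset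
      (forcedTraces_subset_powerset _ _ _))
  · intro x hx
    exact ⟨param x, rfl, fun i hi =>
      ⟨_, (key x hx ⟨i, hi⟩).1, mem_gridRealization α (hx.2 ⟨i, hi⟩)⟩⟩
  · intro x hx y hy hxy
    funext i
    have h1 := transfer x hx _ hxy i
    have h2 := transfer y hy _ hxy.symm i
    by_cases hi : i.1 ∈ J'
    · have hvx := (key x hx i).2 hi
      have hvy := (key y hy i).2 hi
      apply toFull_injective m J' i.1 α
      dsimp only
      rw [hvx] at h1 ⊢
      rw [hvy] at h2 ⊢
      exact 𝒳.vertex_eq_of_mem_sec h1 h2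
    · exact 𝒳.toFull_unique hi h1 (key y hy i).1

/-- `δ_{E_{J,J'}}(t) = O(π̃_{𝒳,J}(t))`. -/
theorem delta_le_forced {I : Type} [Fintype I] [DecidableEq I] {m : I → ℕ} {n : ℕ}
    (𝒳 : SimpleFam I m n) (J J' : Finset I) (hJ : J' ⊆ J) :
    ∃ C : ℝ, 0 < C ∧ ∀ t : ℕ, 1 ≤ t →
      (gridDelta J J' (Ecrit 𝒳 J J') t : ℝ) ≤ C * (forcedShatter 𝒳.mem ↑J t : ℝ) := by
  refine ⟨1, one_pos, fun t _ => ?_⟩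
  rw [one_mul, Nat.cast_le]
  refine csSup_le' ?_
  rintro N ⟨W, rfl, rfl⟩
  exact 𝒳.ncard_Ecrit_inter_le J J' W
end

section
/- Suppose E is a non-empty open subset (in the subspace topology) of an affine subspace V of ℝ^{d₁} × ⋯ × ℝ^{d_k}, and suppose there is t > 0 such that E contains no grid A₁ × ⋯ × A_k with A_i ⊆ ℝ^{d_i} and |A_i| = t for every i. Then there is some i ∈ [k] such that the coordinate projection p_i : ℝ^{d₁} × ⋯ × ℝ^{d_k} → ℝ^{d₁} × ⋯ × ℝ^{d_{i−1}} × ℝ^{d_{i+1}} × ⋯ × ℝ^{d_k} (which forgets the i-th block of coordinates) is one-to-one on V. -/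
/-- A flat (affine subspace): the solution set of a finite system of linear
equations with real coefficients. -/
def IsFlat {E : Type*} [AddCommGroup E] [Module ℝ E] (Z : Set E) : Prop :=
  ∃ (k : ℕ) (f : Fin k → E →ₗ[ℝ] ℝ) (c : Fin k → ℝ), Z = {x | ∀ i, f i x = c i}

/-- if `E` is a nonempty relatively open subset of an affine
subspace `V` of `ℝ^{d₁} × ⋯ × ℝ^{d_k}` containing no `k`-grid with all sides
of size `t`, then some coordinate-block projection is one-to-one on `V`. -/
theorem open_subset_flat_no_grid_dependent {k : ℕ} {d : Fin k → ℕ}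
    (V E : Set (∀ i : Fin k, Fin (d i) → ℝ))
    (hV : IsFlat V) (hEne : E.Nonempty) (hEV : E ⊆ V)
    (hopen : ∃ U : Set (∀ i : Fin k, Fin (d i) → ℝ), IsOpen U ∧ E = U ∩ V)
    (t : ℕ) (ht : 0 < t)
    (hgrid : ¬ ∃ A : ∀ i : Fin k, Finset (Fin (d i) → ℝ),
      (∀ i, (A i).card = t) ∧ {x | ∀ i, x i ∈ A i} ⊆ E) :
    ∃ i : Fin k, Set.InjOn
      (fun (x : ∀ j : Fin k, Fin (d j) → ℝ) => fun j : {j : Fin k // j ≠ i} => x j.1)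
      V := by
  classical
  obtain ⟨n, f, c, rfl⟩ := hV
  obtain ⟨U, hU, rfl⟩ := hopen
  obtain ⟨e, heU, heV⟩ := hEne
  by_contra hinj
  push Not at hinj
  -- Non-injectivity gives a nonzero direction of `V` inside each block.
  have hdir : ∀ i, ∃ v : Fin (d i) → ℝ, v ≠ 0 ∧ ∀ j, f j (Pi.single i v) = 0 := by
    intro i
    have hi := hinj i
    simp only [Set.InjOn, not_forall] at hi
    obtain ⟨x, hx, y, hy, hxy, hne⟩ := hi
    have hoff : ∀ j, j ≠ i → x j = y j := fun j hj => congrFun hxy ⟨j, hj⟩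
    have hsingle : Pi.single i (x i - y i) = x - y := by
      ext1 j
      by_cases hj : j = i
      · subst hj
        simp
      · simp [hj, hoff j hj]
    refine ⟨x i - y i, fun h => hne ?_, fun j => ?_⟩
    · rwa [h, Pi.single_zero, eq_comm, sub_eq_zero] at hsingle
    · rw [hsingle, map_sub, hx j, hy j, sub_self]
  choose v hv hfv using hdir
  let φ : (Fin k → ℝ) → ∀ i : Fin k, Fin (d i) → ℝ := fun a i => e i + a i • v i
  have hφV : ∀ a j, f j (φ a) = c j := by
    intro a j
    have hφ : φ a = e + ∑ i, a i • Pi.single i (v i) := by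
      rw [show φ a = e + fun i => a i • v i from rfl,
        ← Finset.univ_sum_single fun i => a i • v i]
      simp only [Pi.single_smul]
    rw [hφ, map_add, map_sum, heV j]
    simp [hfv]
  have hφc : Continuous φ := by fun_prop
  have hφ0 : (0 : Fin k → ℝ) ∈ φ ⁻¹' U := by
    have : φ 0 = e := by
      ext1 i
      simp [φ]
    rwa [Set.mem_preimage, this]
  obtain ⟨r, hr, hball⟩ := Metric.isOpen_iff.1 (hU.preimage hφc) 0 hφ0
  have ht' : (0 : ℝ) < t := Nat.cast_pos.2 ht
  refine hgrid ⟨fun i => (Finset.range t).image fun m : ℕ => e i + (r / t * m) • v i,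
    fun i => ?_, fun x hx => ?_⟩
  · rw [Finset.card_image_of_injective, Finset.card_range]
    intro m m' h
    have h' := smul_left_injective ℝ (hv i) (add_left_cancel h)
    exact_mod_cast mul_left_cancel₀ (div_pos hr ht').ne' h'
  · simp only [Set.mem_ofPred_eq, Finset.mem_image, Finset.mem_range] at hx
    choose m hm hxm using hx
    have hxφ : φ (fun i => r / t * m i) = x := funext hxm
    rw [← hxφ]
    refine ⟨hball ?_, hφV _⟩
    rw [Metric.mem_ball, dist_pi_lt_iff hr]
    intro i
    rw [Pi.zero_apply, Real.dist_0_eq_abs, abs_of_nonneg (by positivity), div_mul_eq_mul_div,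
      div_lt_iff₀ ht']
    exact mul_lt_mul_of_pos_left (Nat.cast_lt.2 (hm i)) hr
end

section
/- Suppose X ⊆ ℝ^m is semilinear. (i) If a flat Z satisfies dim(X ∩ Z) = dim(Z), then Z ⊆ fcl(X). (ii) If Z₁,…,Z_ℓ ⊆ ℝ^m are flats such that none of them contains another and X ⊆ Z₁ ∪ ⋯ ∪ Z_ℓ, then fcl(X) = Z₁ ∪ ⋯ ∪ Z_ℓ if and only if dim(X ∩ Z_i) = dim(Z_i) for every i ∈ [ℓ]. (iii) dim(fcl(X)) = dim(X). -/
open Classical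

/-- A basic semilinear set: the solution set of a finite system of linear
equations and (strict or weak) linear inequalities with real coefficients. -/
def IsBasicSemilinear {E : Type*} [AddCommGroup E] [Module ℝ E] (S : Set E) : Prop :=
  ∃ (k : ℕ) (f : Fin k → E →ₗ[ℝ] ℝ) (c : Fin k → ℝ) (rel : Fin k → ℝ → ℝ → Prop),
    (∀ i, rel i = (· = ·) ∨ rel i = (· < ·) ∨ rel i = (· ≤ ·)) ∧
    S = {x | ∀ i, rel i (f i x) (c i)}

/-- A semilinear set: a finite union of basic semilinear sets. -/
def IsSemilinear {E : Type*} [AddCommGroup E] [Module ℝ E] (S : Set E) : Prop :=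
  ∃ (N : ℕ) (T : Fin N → Set E), (∀ j, IsBasicSemilinear (T j)) ∧ S = ⋃ j, T j

/-- A closed set in the flat topology: a finite union of flats. -/
def IsFlatClosed {E : Type*} [AddCommGroup E] [Module ℝ E] (C : Set E) : Prop :=
  ∃ (N : ℕ) (Z : Fin N → Set E), (∀ j, IsFlat (Z j)) ∧ C = ⋃ j, Z j

/-- The closure of `X` in the flat topology. -/
def fcl {E : Type*} [AddCommGroup E] [Module ℝ E] (X : Set E) : Set E :=
  ⋂₀ {C | IsFlatClosed C ∧ X ⊆ C}

/-- The o-minimal dimension of `X ⊆ ℝ^m`: the largest `d` such that the image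
of `X` under some coordinate projection `ℝ^m → ℝ^d` has nonempty interior,
with `dim ∅ = ⊥ (= −∞)`. -/
noncomputable def sldim {m : ℕ} (X : Set (Fin m → ℝ)) : WithBot ℤ :=
  if X = ∅ then ⊥ else
    (((sSup {d : ℕ | ∃ s : Fin d → Fin m, Function.Injective s ∧
      (interior ((fun x (j : Fin d) => x (s j)) '' X)).Nonempty} : ℕ) : ℤ) : WithBot ℤ)

/-- The local dimension of `X` at `a`: the infimum of `dim (U ∩ X)` over open
neighborhoods `U` of `a`. -/
noncomputable def sldimAt {m : ℕ} (X : Set (Fin m → ℝ)) (a : Fin m → ℝ) : WithBot ℤ :=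
  sInf {n : WithBot ℤ | ∃ U : Set (Fin m → ℝ), IsOpen U ∧ a ∈ U ∧ n = sldim (U ∩ X)}

/-- The open cube centered at `a` of half side length `r`. -/
def cube {m : ℕ} (a : Fin m → ℝ) (r : ℝ) : Set (Fin m → ℝ) :=
  {x | ∀ j, |x j - a j| < r}

/-- The boundary of `X` relative to the flat `Z`: points of `Z` every open
cube around which meets both `X` and `Z ∖ X`. -/
def bdIn {m : ℕ} (Z X : Set (Fin m → ℝ)) : Set (Fin m → ℝ) :=
  {a | a ∈ Z ∧ ∀ r : ℝ, 0 < r →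
    (cube a r ∩ X).Nonempty ∧ (cube a r ∩ (Z \ X)).Nonempty}

/-- The essential boundary of `X` relative to the flat `Z`: points `a ∈ Z`
with `dim_a(Z ∩ X) = dim_a(Z ∖ X) = dim_a(Z) = dim Z`. -/
def esbIn {m : ℕ} (Z X : Set (Fin m → ℝ)) : Set (Fin m → ℝ) :=
  {a | a ∈ Z ∧ sldimAt (Z ∩ X) a = sldim Z ∧ sldimAt (Z \ X) a = sldim Z ∧
    sldimAt Z a = sldim Z}

/-- A half-flat of the flat `Z`: a nonempty proper subset of `Z` of the form
`{a ∈ Z : λ(a) < c}` or `{a ∈ Z : λ(a) ≤ c}`. -/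
def IsHalfFlatOf {E : Type*} [AddCommGroup E] [Module ℝ E] (Z H : Set E) : Prop :=
  H.Nonempty ∧ H ≠ Z ∧ ∃ (f : E →ₗ[ℝ] ℝ) (c : ℝ),
    H = {a ∈ Z | f a < c} ∨ H = {a ∈ Z | f a ≤ c}

/-- A closed half-flat of the flat `Z`. -/
def IsClosedHalfFlatOf {E : Type*} [AddCommGroup E] [Module ℝ E] (Z H : Set E) : Prop :=
  H.Nonempty ∧ H ≠ Z ∧ ∃ (f : E →ₗ[ℝ] ℝ) (c : ℝ), H = {a ∈ Z | f a ≤ c}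

/-- `a` witnesses that the half-flat `H ⊆ Z` is essential for `X`:
`a ∈ bd(H)` and some open cube `C` centered at `a` has `X ∩ C = H ∩ C`. -/
def WitnessEssential {m : ℕ} (Z X H : Set (Fin m → ℝ)) (a : Fin m → ℝ) : Prop :=
  a ∈ bdIn Z H ∧ ∃ r : ℝ, 0 < r ∧ X ∩ cube a r = H ∩ cube a r

/-- The half-flat `H ⊆ Z` is essential for `X`. -/
def EssentialFor {m : ℕ} (Z X H : Set (Fin m → ℝ)) : Prop :=
  ∃ a, WitnessEssential Z X H a

open Module

/-- The solution set of a system of linear equations is an affine subspace. -/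
theorem IsFlat.exists_affineSubspace {E : Type*} [AddCommGroup E] [Module ℝ E] {Z : Set E}
    (hZ : IsFlat Z) : ∃ A : AffineSubspace ℝ E, (A : Set E) = Z := by
  obtain ⟨k, f, c, rfl⟩ := hZ
  refine ⟨⟨{x | ∀ i, f i x = c i}, ?_⟩, rfl⟩
  intro t p q r hp hq hr i
  simp [hp i, hq i, hr i]

/-- Every affine subspace of a finite-dimensional space is a flat. -/
theorem AffineSubspace.isFlat {E : Type*} [AddCommGroup E] [Module ℝ E] [FiniteDimensional ℝ E]
    (A : AffineSubspace ℝ E) : IsFlat (A : Set E) := by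
  rcases (A : Set E).eq_empty_or_nonempty with hA | ⟨p, hp⟩
  · exact ⟨1, fun _ => 0, fun _ => 1, by simp [hA]⟩
  · let b := finBasis ℝ (E ⧸ A.direction)
    refine ⟨_, fun i => b.coord i ∘ₗ A.direction.mkQ, fun i => b.coord i (A.direction.mkQ p), ?_⟩
    ext x
    have h : (∀ i, b.coord i (A.direction.mkQ x) = b.coord i (A.direction.mkQ p)) ↔
        A.direction.mkQ x = A.direction.mkQ p :=
      ⟨fun h => b.ext_elem h, fun h i => by rw [h]⟩
    simp only [LinearMap.comp_apply, Set.mem_ofPred_eq]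
    rw [h, Submodule.mkQ_apply, Submodule.mkQ_apply, Submodule.Quotient.eq, ← vsub_eq_sub,
      AffineSubspace.vsub_right_mem_direction_iff_mem hp, SetLike.mem_coe]

theorem IsBasicSemilinear.convex {E : Type*} [AddCommGroup E] [Module ℝ E] {S : Set E}
    (hS : IsBasicSemilinear S) : Convex ℝ S := by
  obtain ⟨k, f, c, rel, hrel, rfl⟩ := hS
  rw [Set.ofPred_forall]
  refine convex_iInter fun i => ?_
  rcases hrel i with h | h | h <;> rw [h]
  · exact convex_hyperplane (f i).isLinear _
  · exact convex_halfSpace_lt (f i).isLinear _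
  · exact convex_halfSpace_le (f i).isLinear _

theorem subset_fcl {E : Type*} [AddCommGroup E] [Module ℝ E] (X : Set E) : X ⊆ fcl X :=
  Set.subset_sInter fun _ hC => hC.2

theorem fcl_subset {E : Type*} [AddCommGroup E] [Module ℝ E] {X C : Set E}
    (hC : IsFlatClosed C) (h : X ⊆ C) : fcl X ⊆ C :=
  Set.sInter_subset_of_mem ⟨hC, h⟩

/-- A finite union of affine subspaces with nonempty interior contains the whole space. -/
theorem AffineSubspace.exists_eq_top_of_interior_iUnion_nonempty {ι : Type*} [Countable ι] {d : ℕ}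
    (A : ι → AffineSubspace ℝ (Fin d → ℝ))
    (h : (interior (⋃ j, (A j : Set (Fin d → ℝ)))).Nonempty) : ∃ j, A j = ⊤ := by
  by_contra! hA
  have h0 : MeasureTheory.volume (⋃ j, (A j : Set (Fin d → ℝ))) = 0 :=
    MeasureTheory.measure_iUnion_null fun j =>
      MeasureTheory.Measure.addHaar_affineSubspace _ (A j) (hA j)
  exact h.ne_empty (MeasureTheory.Measure.interior_eq_empty_of_null h0)

/-- Every subspace of `ℝ^m` projects onto some coordinate subspace of the same dimension. -/
theorem Submodule.exists_map_funLeft_eq_top {m : ℕ} (V : Submodule ℝ (Fin m → ℝ)) :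
    ∃ s : Fin (finrank ℝ V) → Fin m, Function.Injective s ∧
      V.map (LinearMap.funLeft ℝ ℝ s) = ⊤ := by
  let φ : Fin m → Dual ℝ V := fun i => LinearMap.proj i ∘ₗ V.subtype
  obtain ⟨κ, a, ha, hspan, hli⟩ := exists_linearIndependent' ℝ φ
  have : Finite κ := Finite.of_injective a ha
  have : Fintype κ := Fintype.ofFinite κ
  let g : V →ₗ[ℝ] κ → ℝ := LinearMap.funLeft ℝ ℝ a ∘ₗ V.subtype
  have hg : Function.Injective g := by
    rw [← LinearMap.ker_eq_bot, LinearMap.ker_eq_bot']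
    intro v hv
    have hle : span ℝ (Set.range φ) ≤ LinearMap.ker (Dual.eval ℝ V v) := by
      rw [← hspan, span_le]
      rintro _ ⟨k, rfl⟩
      exact congrFun hv k
    ext i
    exact hle (subset_span ⟨i, rfl⟩)
  have hcard : Fintype.card κ = finrank ℝ V := by
    refine le_antisymm ?_ ?_
    · simpa using hli.fintype_card_le_finrank
    · simpa using LinearMap.finrank_le_finrank_of_injective hg
  let e : Fin (finrank ℝ V) ≃ κ := (Fintype.equivFinOfCardEq hcard).symm
  refine ⟨a ∘ e, ha.comp e.injective, ?_⟩
  have hsurj : Function.Surjective g :=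
    (LinearMap.injective_iff_surjective_of_finrank_eq_finrank (by simp [hcard])).1 hg
  rw [eq_top_iff']
  intro y
  obtain ⟨v, hv⟩ := hsurj (y ∘ e.symm)
  refine ⟨v, v.2, ?_⟩
  ext i
  exact (congrFun hv (e i)).trans (congrArg y (e.symm_apply_apply i))

/-- The dimensions of the coordinate spaces in which the projection of `X` has interior. -/
def coordDims {m : ℕ} (X : Set (Fin m → ℝ)) : Set ℕ :=
  {d : ℕ | ∃ s : Fin d → Fin m, Function.Injective s ∧
    (interior ((fun x (j : Fin d) => x (s j)) '' X)).Nonempty}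

theorem bddAbove_coordDims {m : ℕ} (X : Set (Fin m → ℝ)) : BddAbove (coordDims X) :=
  ⟨m, fun _ ⟨_, hs, _⟩ => by simpa using Fintype.card_le_of_injective _ hs⟩

theorem coordDims_mono {m : ℕ} {X Y : Set (Fin m → ℝ)} (h : X ⊆ Y) :
    coordDims X ⊆ coordDims Y :=
  fun _ ⟨s, hs, hi⟩ => ⟨s, hs, hi.mono (interior_mono (Set.image_mono h))⟩

theorem zero_mem_coordDims {m : ℕ} {X : Set (Fin m → ℝ)} (hX : X.Nonempty) :
    0 ∈ coordDims X := by
  refine ⟨Fin.elim0, fun i => i.elim0, ?_⟩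
  rw [Subsingleton.eq_univ_of_nonempty (hX.image _), interior_univ]
  exact Set.univ_nonempty

theorem sldim_eq {m : ℕ} {X : Set (Fin m → ℝ)} (hX : X.Nonempty) :
    sldim X = (((sSup (coordDims X) : ℕ) : ℤ) : WithBot ℤ) :=
  if_neg hX.ne_empty

@[simp]
theorem sldim_empty {m : ℕ} : sldim (∅ : Set (Fin m → ℝ)) = ⊥ :=
  if_pos rfl

theorem sldim_eq_of_isGreatest {m d : ℕ} {X : Set (Fin m → ℝ)} (hX : X.Nonempty)
    (h : IsGreatest (coordDims X) d) : sldim X = ((d : ℤ) : WithBot ℤ) := by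
  rw [sldim_eq hX, h.csSup_eq]

theorem isGreatest_of_sldim_eq {m d : ℕ} {X : Set (Fin m → ℝ)}
    (h : sldim X = ((d : ℤ) : WithBot ℤ)) : IsGreatest (coordDims X) d := by
  rcases X.eq_empty_or_nonempty with rfl | hX
  · simp at h
  · rw [sldim_eq hX] at h
    have h' : sSup (coordDims X) = d := by exact_mod_cast h
    rw [← h']
    exact ⟨Nat.sSup_mem ⟨0, zero_mem_coordDims hX⟩ (bddAbove_coordDims X),
      fun _ hd => le_csSup (bddAbove_coordDims X) hd⟩

theorem sldim_mono {m : ℕ} {X Y : Set (Fin m → ℝ)} (h : X ⊆ Y) : sldim X ≤ sldim Y := by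
  rcases X.eq_empty_or_nonempty with rfl | hX
  · simp
  · rw [sldim_eq hX, sldim_eq (hX.mono h)]
    exact_mod_cast csSup_le_csSup (bddAbove_coordDims Y) ⟨0, zero_mem_coordDims hX⟩
      (coordDims_mono h)

/-- If finitely many affine subspaces cover a set, any coordinate dimension of the set is at most
the dimension of one of them. -/
theorem exists_le_finrank_direction_of_mem_coordDims {m d : ℕ} {ι : Type*} [Countable ι]
    {Y : Set (Fin m → ℝ)} {A : ι → AffineSubspace ℝ (Fin m → ℝ)}
    (hY : Y ⊆ ⋃ j, (A j : Set (Fin m → ℝ))) (hd : d ∈ coordDims Y) :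
    ∃ j, (A j : Set (Fin m → ℝ)).Nonempty ∧ d ≤ finrank ℝ (A j).direction := by
  obtain ⟨s, -, hi⟩ := hd
  let π : (Fin m → ℝ) →ₗ[ℝ] (Fin d → ℝ) := LinearMap.funLeft ℝ ℝ s
  obtain ⟨j, hj⟩ := AffineSubspace.exists_eq_top_of_interior_iUnion_nonempty
    (fun j => (A j).map π.toAffineMap) (by
      refine hi.mono (interior_mono ?_)
      refine (Set.image_mono hY).trans ?_
      rw [Set.image_iUnion]
      exact subset_rfl)
  refine ⟨j, ?_, ?_⟩
  · rw [← Set.image_nonempty (f := π.toAffineMap), ← AffineSubspace.coe_map, hj]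
    exact Set.univ_nonempty
  · have h := congrArg AffineSubspace.direction hj
    rw [AffineSubspace.map_direction, AffineSubspace.direction_top] at h
    have h' := Submodule.finrank_map_le π (A j).direction
    rw [show (A j).direction.map π = ⊤ from h, finrank_top] at h'
    simpa using h'

/-- The coordinate dimension of a nonempty convex set is the dimension of its affine span. -/
theorem Convex.isGreatest_coordDims {m : ℕ} {T : Set (Fin m → ℝ)} (hT : Convex ℝ T)
    (hne : T.Nonempty) : IsGreatest (coordDims T) (finrank ℝ (affineSpan ℝ T).direction) := by
  refine ⟨?_, fun d hd => ?_⟩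
  · obtain ⟨s, hs, hmap⟩ := (affineSpan ℝ T).direction.exists_map_funLeft_eq_top
    refine ⟨s, hs, ?_⟩
    let π := LinearMap.funLeft ℝ ℝ s
    change (interior (π '' T)).Nonempty
    rw [(hT.linear_image π).interior_nonempty_iff_affineSpan_eq_top]
    have hspan : affineSpan ℝ (π '' T) = (affineSpan ℝ T).map π.toAffineMap :=
      (AffineSubspace.map_span π.toAffineMap T).symm
    rw [hspan, ← AffineSubspace.direction_eq_top_iff_of_nonempty, AffineSubspace.map_direction]
    · exact hmap
    · exact ((affineSpan_nonempty ℝ).2 hne).image _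
  · obtain ⟨-, -, h⟩ := exists_le_finrank_direction_of_mem_coordDims (ι := Unit)
      (A := fun _ => affineSpan ℝ T)
      ((subset_affineSpan ℝ T).trans (Set.subset_iUnion_of_subset () subset_rfl)) hd
    exact h

theorem Convex.sldim_eq {m : ℕ} {T : Set (Fin m → ℝ)} (hT : Convex ℝ T) (hne : T.Nonempty) :
    sldim T = ((finrank ℝ (affineSpan ℝ T).direction : ℤ) : WithBot ℤ) :=
  sldim_eq_of_isGreatest hne (hT.isGreatest_coordDims hne)

theorem AffineSubspace.sldim_eq {m : ℕ} {A : AffineSubspace ℝ (Fin m → ℝ)}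
    (hA : (A : Set (Fin m → ℝ)).Nonempty) :
    sldim (A : Set (Fin m → ℝ)) = ((finrank ℝ A.direction : ℤ) : WithBot ℤ) := by
  rw [A.convex.sldim_eq hA, AffineSubspace.affineSpan_coe]

theorem Convex.sldim_affineSpan {m : ℕ} {T : Set (Fin m → ℝ)} (hT : Convex ℝ T) :
    sldim (affineSpan ℝ T : Set (Fin m → ℝ)) = sldim T := by
  rcases T.eq_empty_or_nonempty with rfl | hne
  · simp
  · rw [hT.sldim_eq hne, AffineSubspace.sldim_eq ((affineSpan_nonempty ℝ).2 hne)]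

/-- A subset of full dimension in a nonempty affine subspace `A` can only be covered by finitely
many affine subspaces if one of them contains `A`. -/
theorem AffineSubspace.exists_le_of_sldim_eq {m : ℕ} {ι : Type*} [Countable ι]
    {A : AffineSubspace ℝ (Fin m → ℝ)} (hA : (A : Set (Fin m → ℝ)).Nonempty)
    {Y : Set (Fin m → ℝ)} (hYA : Y ⊆ A) (hY : sldim Y = sldim (A : Set (Fin m → ℝ)))
    {B : ι → AffineSubspace ℝ (Fin m → ℝ)} (hYB : Y ⊆ ⋃ j, (B j : Set (Fin m → ℝ))) :
    ∃ j, A ≤ B j := by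
  rw [AffineSubspace.sldim_eq hA] at hY
  obtain ⟨j, hne, hj⟩ := exists_le_finrank_direction_of_mem_coordDims (A := fun j => A ⊓ B j)
    ((Set.subset_inter hYA hYB).trans (Set.inter_iUnion _ _).subset) (isGreatest_of_sldim_eq hY).1
  refine ⟨j, inf_eq_left.1 ?_⟩
  exact AffineSubspace.eq_of_direction_eq_of_nonempty_of_le
    (Submodule.eq_of_le_of_finrank_le (AffineSubspace.direction_le inf_le_left) hj) hne inf_le_left

theorem IsFlat.subset_fcl_of_sldim_inter_eq {m : ℕ} {X Z : Set (Fin m → ℝ)} (hZ : IsFlat Z)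
    (h : sldim (X ∩ Z) = sldim Z) : Z ⊆ fcl X := by
  obtain ⟨A, rfl⟩ := hZ.exists_affineSubspace
  rcases (A : Set (Fin m → ℝ)).eq_empty_or_nonempty with hA | hA
  · simp [hA]
  refine Set.subset_sInter ?_
  rintro C ⟨⟨N, W, hW, rfl⟩, hXC⟩
  choose B hB using fun j => (hW j).exists_affineSubspace
  obtain rfl : (fun j => (B j : Set (Fin m → ℝ))) = W := funext hB
  obtain ⟨j, hj⟩ := AffineSubspace.exists_le_of_sldim_eq hA Set.inter_subset_right h
    (Set.inter_subset_left.trans hXC)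
  exact Set.subset_iUnion_of_subset j hj

/-- The flat closure of a finite union of convex sets is the union of their affine spans. -/
theorem fcl_iUnion_of_convex {m N : ℕ} {T : Fin N → Set (Fin m → ℝ)}
    (hT : ∀ j, Convex ℝ (T j)) :
    fcl (⋃ j, T j) = ⋃ j, (affineSpan ℝ (T j) : Set (Fin m → ℝ)) := by
  refine (fcl_subset ⟨N, _, fun j => (affineSpan ℝ (T j)).isFlat, rfl⟩
    (Set.iUnion_mono fun j => subset_affineSpan ℝ (T j))).antisymm (Set.iUnion_subset fun j => ?_)
  refine (affineSpan ℝ (T j)).isFlat.subset_fcl_of_sldim_inter_eq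
    ((sldim_mono Set.inter_subset_right).antisymm ?_)
  rw [(hT j).sldim_affineSpan]
  exact sldim_mono (Set.subset_inter (Set.subset_iUnion T j) (subset_affineSpan ℝ (T j)))

theorem sldim_fcl {m : ℕ} {X : Set (Fin m → ℝ)} (hX : IsSemilinear X) :
    sldim (fcl X) = sldim X := by
  refine le_antisymm ?_ (sldim_mono (subset_fcl X))
  obtain ⟨N, T, hT, rfl⟩ := hX
  rw [fcl_iUnion_of_convex fun j => (hT j).convex]
  rcases (⋃ j, (affineSpan ℝ (T j) : Set (Fin m → ℝ))).eq_empty_or_nonempty with h | h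
  · simp [h]
  · have hd := Nat.sSup_mem ⟨0, zero_mem_coordDims h⟩ (bddAbove_coordDims _)
    obtain ⟨j, hne, hj⟩ := exists_le_finrank_direction_of_mem_coordDims subset_rfl hd
    calc
      _ = _ := sldim_eq h
      _ ≤ ((finrank ℝ (affineSpan ℝ (T j)).direction : ℤ) : WithBot ℤ) := by exact_mod_cast hj
      _ = sldim (T j) := ((hT j).convex.sldim_eq ((affineSpan_nonempty ℝ).1 hne)).symm
      _ ≤ _ := sldim_mono (Set.subset_iUnion T j)

theorem IsFlat.exists_subset_of_subset_iUnion {m : ℕ} {ι : Type*} [Countable ι]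
    {Z : Set (Fin m → ℝ)} (hZ : IsFlat Z) (hne : Z.Nonempty) {W : ι → Set (Fin m → ℝ)}
    (hW : ∀ j, IsFlat (W j)) (h : Z ⊆ ⋃ j, W j) : ∃ j, Z ⊆ W j := by
  obtain ⟨A, rfl⟩ := hZ.exists_affineSubspace
  choose B hB using fun j => (hW j).exists_affineSubspace
  obtain rfl : (fun j => (B j : Set (Fin m → ℝ))) = W := funext hB
  exact AffineSubspace.exists_le_of_sldim_eq hne subset_rfl rfl h

theorem sldim_inter_eq_of_fcl_eq_iUnion {m ℓ : ℕ} {X : Set (Fin m → ℝ)} (hX : IsSemilinear X)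
    {Z : Fin ℓ → Set (Fin m → ℝ)} (hZ : ∀ i, IsFlat (Z i))
    (hanti : ∀ i j, i ≠ j → ¬ Z i ⊆ Z j) (h : fcl X = ⋃ i, Z i) (i : Fin ℓ) :
    sldim (X ∩ Z i) = sldim (Z i) := by
  rcases (Z i).eq_empty_or_nonempty with hne | hne
  · simp [hne]
  obtain ⟨N, T, hT, rfl⟩ := hX
  rw [fcl_iUnion_of_convex fun j => (hT j).convex] at h
  obtain ⟨j, hj⟩ := (hZ i).exists_subset_of_subset_iUnion hne
    (fun j => (affineSpan ℝ (T j)).isFlat) (h ▸ Set.subset_iUnion Z i)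
  obtain ⟨k, hk⟩ := (affineSpan ℝ (T j)).isFlat.exists_subset_of_subset_iUnion (hne.mono hj) hZ
    (h ▸ Set.subset_iUnion (fun j => (affineSpan ℝ (T j) : Set (Fin m → ℝ))) j)
  obtain rfl : i = k := by_contra fun hik => hanti i k hik (hj.trans hk)
  refine (sldim_mono Set.inter_subset_right).antisymm ((sldim_mono hj).trans ?_)
  rw [(hT j).convex.sldim_affineSpan]
  exact sldim_mono (Set.subset_inter (Set.subset_iUnion T j) ((subset_affineSpan ℝ _).trans hk))

/-- (i) a flat `Z` with `dim(X ∩ Z) = dim Z` is contained in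
`fcl X`; (ii) if `X` is covered by flats `Z₁, …, Z_ℓ`, none containing
another, then `fcl X = Z₁ ∪ ⋯ ∪ Z_ℓ` iff `dim(X ∩ Z_i) = dim Z_i` for all `i`;
(iii) `dim (fcl X) = dim X`. -/
theorem fcl_dim_props {m : ℕ} (X : Set (Fin m → ℝ)) (hX : IsSemilinear X) :
    (∀ Z : Set (Fin m → ℝ), IsFlat Z → sldim (X ∩ Z) = sldim Z → Z ⊆ fcl X) ∧
    (∀ (ℓ : ℕ) (Z : Fin ℓ → Set (Fin m → ℝ)), (∀ i, IsFlat (Z i)) →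
      (∀ i j, i ≠ j → ¬ Z i ⊆ Z j) → X ⊆ ⋃ i, Z i →
      (fcl X = ⋃ i, Z i ↔ ∀ i, sldim (X ∩ Z i) = sldim (Z i))) ∧
    sldim (fcl X) = sldim X := by
  refine ⟨fun Z hZ h => hZ.subset_fcl_of_sldim_inter_eq h, fun ℓ Z hZ hanti hcov => ?_,
    sldim_fcl hX⟩
  refine ⟨sldim_inter_eq_of_fcl_eq_iUnion hX hZ hanti, fun h => ?_⟩
  exact (fcl_subset ⟨ℓ, Z, hZ, rfl⟩ hcov).antisymm
    (Set.iUnion_subset fun i => (hZ i).subset_fcl_of_sldim_inter_eq (h i))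
end

section
/- Let X ⊆ ℝ^m be a semilinear set such that Z = fcl(X) is a flat with dim(Z) = dim(X) = d. Then there exist ℓ ∈ ℕ and a collection of half-flats {H₁,…,H_ℓ} contained in Z which is an essential approximation of X. -/
open Classical

/-- An essential approximation of `X` (relative to the flat `Z = fcl X`):
a list of half-flats of `Z`, each essential for `X`, whose boundaries are
pairwise distinct and realize the boundary of every half-flat essential
for `X`. -/
def IsEssentialApprox {m : ℕ} (Z X : Set (Fin m → ℝ)) {ℓ : ℕ}
    (H : Fin ℓ → Set (Fin m → ℝ)) : Prop :=
  (∀ i, IsHalfFlatOf Z (H i) ∧ EssentialFor Z X (H i)) ∧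
  (∀ H' : Set (Fin m → ℝ), IsHalfFlatOf Z H' → EssentialFor Z X H' →
    ∃ i, bdIn Z H' = bdIn Z (H i)) ∧
  (∀ i j, i ≠ j → bdIn Z (H i) ≠ bdIn Z (H j))

open Filter Topology

theorem cube_eq_ball {m : ℕ} (a : Fin m → ℝ) {r : ℝ} (hr : 0 < r) :
    cube a r = Metric.ball a r := by
  ext x
  simp [cube, dist_pi_lt_iff hr, Real.dist_eq]

theorem mem_bdIn_iff {m : ℕ} {Z X : Set (Fin m → ℝ)} {a : Fin m → ℝ} :
    a ∈ bdIn Z X ↔ a ∈ Z ∧ (∃ᶠ x in 𝓝 a, x ∈ X) ∧ ∃ᶠ x in 𝓝 a, x ∈ Z \ X := by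
  simp only [Metric.nhds_basis_ball.frequently_iff, ← forall₂_and]
  refine and_congr_right fun _ => forall₂_congr fun r hr => ?_
  rw [cube_eq_ball a hr]
  rfl

theorem not_eventually_mem_iff_of_mem_bdIn {m : ℕ} {Z X : Set (Fin m → ℝ)}
    (hXZ : X ⊆ Z) {a : Fin m → ℝ} (ha : a ∈ bdIn Z X) (p : Prop) :
    ¬ ∀ᶠ x in 𝓝 a, x ∈ Z → (x ∈ X ↔ p) := by
  intro h
  obtain ⟨-, hin, hout⟩ := mem_bdIn_iff.1 ha
  obtain ⟨x, hx, hxp⟩ := (hin.and_eventually h).exists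
  obtain ⟨y, hy, hyp⟩ := (hout.and_eventually h).exists
  exact hy.2 ((hyp hy.1).2 ((hxp (hXZ hx)).1 hx))

theorem IsFlat.add_smul_sub_mem {E : Type*} [AddCommGroup E] [Module ℝ E] {Z : Set E}
    (hZ : IsFlat Z) {x y z : E} (hx : x ∈ Z) (hy : y ∈ Z) (hz : z ∈ Z) (t : ℝ) :
    x + t • (y - z) ∈ Z := by
  obtain ⟨k, f, c, rfl⟩ := hZ
  intro i
  simp [hx i, hy i, hz i]

/-- Away from the hyperplane `f = c`, each of the relations `f x = c`, `f x < c`, `f x ≤ c`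
is locally constant in `x`. -/
theorem eventually_rel_iff {m : ℕ} (f : (Fin m → ℝ) →ₗ[ℝ] ℝ) {c : ℝ} {rel : ℝ → ℝ → Prop}
    (hrel : rel = (· = ·) ∨ rel = (· < ·) ∨ rel = (· ≤ ·)) {x : Fin m → ℝ} (hx : f x ≠ c) :
    ∀ᶠ y in 𝓝 x, (rel (f y) c ↔ rel (f x) c) := by
  have hf : Tendsto f (𝓝 x) (𝓝 (f x)) := f.continuous_of_finiteDimensional.continuousAt
  rcases hx.lt_or_gt with h | h
  · filter_upwards [hf.eventually (eventually_lt_nhds h)] with y hy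
    rcases hrel with rfl | rfl | rfl
    · exact iff_of_false hy.ne h.ne
    · exact iff_of_true hy h
    · exact iff_of_true hy.le h.le
  · filter_upwards [hf.eventually (eventually_gt_nhds h)] with y hy
    rcases hrel with rfl | rfl | rfl
    · exact iff_of_false hy.ne' h.ne'
    · exact iff_of_false hy.not_gt h.not_gt
    · exact iff_of_false hy.not_ge h.not_ge

/-- A semilinear set is cut out by finitely many hyperplanes: on any `Z`, membership is locally
constant off those that are nontrivial on `Z`. -/
theorem IsSemilinear.exists_eventually_mem_iff {m : ℕ} {X : Set (Fin m → ℝ)}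
    (hX : IsSemilinear X) :
    ∃ (ι : Type) (_ : Finite ι) (f : ι → (Fin m → ℝ) →ₗ[ℝ] ℝ) (c : ι → ℝ),
      ∀ (Z : Set (Fin m → ℝ)) (x : Fin m → ℝ),
        (∀ i, (∀ y ∈ Z, f i y = f i x) ∨ f i x ≠ c i) →
        ∀ᶠ y in 𝓝 x, y ∈ Z → (y ∈ X ↔ x ∈ X) := by
  obtain ⟨N, T, hT, rfl⟩ := hX
  choose k f c rel hrel hTeq using hT
  refine ⟨Σ j, Fin (k j), inferInstance, fun i => f i.1 i.2, fun i => c i.1 i.2, ?_⟩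
  intro Z x h
  have key : ∀ i : Σ j, Fin (k j), ∀ᶠ y in 𝓝 x, y ∈ Z →
      (rel i.1 i.2 (f i.1 i.2 y) (c i.1 i.2) ↔ rel i.1 i.2 (f i.1 i.2 x) (c i.1 i.2)) := by
    intro i
    rcases h i with hi | hi
    · exact .of_forall fun y hy => by rw [hi y hy]
    · exact (eventually_rel_iff _ (hrel i.1 i.2) hi).mono fun y hy _ => hy
  filter_upwards [eventually_all.2 key] with y hy hyZ
  simp only [Set.mem_iUnion]
  refine exists_congr fun j => ?_
  rw [hTeq j]
  exact forall_congr' fun i => hy ⟨j, i⟩ hyZ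

theorem IsHalfFlatOf.exists_bdIn_eq {m : ℕ} {Z H : Set (Fin m → ℝ)} (hZ : IsFlat Z)
    (hH : IsHalfFlatOf Z H) :
    H ⊆ Z ∧ ∃ (f : (Fin m → ℝ) →ₗ[ℝ] ℝ) (c : ℝ), bdIn Z H = {x ∈ Z | f x = c} := by
  obtain ⟨⟨p, hp⟩, hne, f, c, hfc⟩ := hH
  have hHZ : H ⊆ Z := by rcases hfc with rfl | rfl <;> exact fun x hx => hx.1
  refine ⟨hHZ, f, c, Set.ext fun x => ⟨fun hx => ⟨hx.1, ?_⟩, fun hx => ?_⟩⟩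
  · by_contra hxc
    rcases hfc with rfl | rfl
    · exact not_eventually_mem_iff_of_mem_bdIn hHZ hx (f x < c)
        ((eventually_rel_iff f (.inr (.inl rfl)) hxc).mono fun y hy hyZ =>
          ⟨fun h => hy.1 h.2, fun h => ⟨hyZ, hy.2 h⟩⟩)
    · exact not_eventually_mem_iff_of_mem_bdIn hHZ hx (f x ≤ c)
        ((eventually_rel_iff f (.inr (.inr rfl)) hxc).mono fun y hy hyZ =>
          ⟨fun h => hy.1 h.2, fun h => ⟨hyZ, hy.2 h⟩⟩)
  · obtain ⟨hxZ, hxc⟩ := hx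
    obtain ⟨q, hqZ, hqc⟩ : ∃ q ∈ Z, f q < c := by
      rcases hfc with rfl | rfl
      · exact ⟨p, hp⟩
      · obtain ⟨q, hqZ, hq⟩ := Set.exists_of_ssubset (hHZ.ssubset_of_ne hne)
        have hq : c < f q := not_le.1 fun h => hq ⟨hqZ, h⟩
        refine ⟨_, hZ.add_smul_sub_mem hxZ hqZ hxZ (-1), ?_⟩
        simp [hxc, hq]
    have hlim : ∀ s : ℝ, Tendsto (fun t : ℝ => x + (s * t) • (q - x)) (𝓝[>] 0) (𝓝 x) := by
      intro s
      have : Continuous fun t : ℝ => x + (s * t) • (q - x) := by fun_prop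
      simpa using (this.tendsto 0).mono_left nhdsWithin_le_nhds
    have hval : ∀ t : ℝ, f (x + t • (q - x)) = c + t * (f q - c) := by simp [hxc]
    refine mem_bdIn_iff.2 ⟨hxZ, (hlim 1).frequently (Eventually.frequently ?_),
      (hlim (-1)).frequently (Eventually.frequently ?_)⟩
    · filter_upwards [self_mem_nhdsWithin] with t ht
      have hlt : f (x + (1 * t) • (q - x)) < c := by
        rw [hval]; nlinarith [mul_pos (Set.mem_Ioi.1 ht) (sub_pos.2 hqc)]
      have hmem := hZ.add_smul_sub_mem hxZ hqZ hxZ (1 * t)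
      rcases hfc with rfl | rfl
      · exact ⟨hmem, hlt⟩
      · exact ⟨hmem, hlt.le⟩
    · filter_upwards [self_mem_nhdsWithin] with t ht
      have hgt : c < f (x + (-1 * t) • (q - x)) := by
        rw [hval]; nlinarith [mul_pos (Set.mem_Ioi.1 ht) (sub_pos.2 hqc)]
      refine ⟨hZ.add_smul_sub_mem hxZ hqZ hxZ (-1 * t), ?_⟩
      rcases hfc with rfl | rfl
      · exact fun h => h.2.not_gt hgt
      · exact fun h => h.2.not_gt hgt

/-- Finitely many hyperplanes, none of which contains the convex set `K`, do not cover `K`. -/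
theorem Convex.exists_forall_ne {E ι : Type*} [AddCommGroup E] [Module ℝ E] {K : Set E}
    (hK : Convex ℝ K) (hne : K.Nonempty) (f : ι → E →ₗ[ℝ] ℝ) (c : ι → ℝ) (s : Finset ι)
    (h : ∀ i ∈ s, ∃ x ∈ K, f i x ≠ c i) : ∃ x ∈ K, ∀ i ∈ s, f i x ≠ c i := by
  induction s using Finset.induction_on with
  | empty => exact hne.imp fun x hx => ⟨hx, by simp⟩
  | insert j s _ ih =>
    obtain ⟨x, hx, hxs⟩ := ih fun i hi => h i (Finset.mem_insert_of_mem hi)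
    obtain ⟨y, hy, hyj⟩ := h j (Finset.mem_insert_self j s)
    have hbad : ∀ i ∈ insert j s, {t : ℝ | f i (x + t • (y - x)) = c i}.Subsingleton := by
      intro i hi t ht u hu
      simp only [Set.mem_ofPred_eq, map_add, map_smul, map_sub, smul_eq_mul] at ht hu
      by_contra htu
      have h0 : (t - u) * (f i y - f i x) = 0 := by linarith
      have h1 : f i y - f i x = 0 := (mul_eq_zero.1 h0).resolve_left (sub_ne_zero.2 htu)
      rw [h1, mul_zero, add_zero] at ht
      rcases Finset.mem_insert.1 hi with rfl | hi
      · exact hyj (by linarith)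
      · exact hxs i hi ht
    have hfin : (⋃ i ∈ insert j s, {t : ℝ | f i (x + t • (y - x)) = c i}).Finite :=
      (insert j s).finite_toSet.biUnion fun i hi => (hbad i hi).finite
    obtain ⟨t, ht, htb⟩ := ((Set.Icc_infinite (zero_lt_one' ℝ)).sdiff hfin).nonempty
    refine ⟨x + t • (y - x), hK.add_smul_sub_mem hx hy ht, fun i hi hit => htb ?_⟩
    exact Set.mem_biUnion hi hit

/-- If the trace on `Z` of one hyperplane is contained, near a point `a`, in another hyperplane
not containing `Z`, then the two traces coincide. -/
theorem IsFlat.sep_eq_of_eventually {m : ℕ} {Z : Set (Fin m → ℝ)} (hZ : IsFlat Z)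
    {f g : (Fin m → ℝ) →ₗ[ℝ] ℝ} {c e : ℝ} {a : Fin m → ℝ} (haZ : a ∈ Z) (ha : f a = c)
    (h : ∀ᶠ x in 𝓝 a, x ∈ Z → f x = c → g x = e) (hg : ∃ y ∈ Z, g y ≠ e) :
    {x ∈ Z | f x = c} = {x ∈ Z | g x = e} := by
  have hga : g a = e := h.self_of_nhds haZ ha
  have hsub : ∀ x ∈ Z, f x = c → g x = e := by
    intro x hxZ hx
    have hlim : Tendsto (fun t : ℝ => a + t • (x - a)) (𝓝[>] 0) (𝓝 a) := by
      have : Continuous fun t : ℝ => a + t • (x - a) := by fun_prop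
      simpa using (this.tendsto 0).mono_left nhdsWithin_le_nhds
    obtain ⟨t, ht, ht0⟩ := ((hlim.eventually h).and self_mem_nhdsWithin).exists
    have hgt := ht (hZ.add_smul_sub_mem haZ hxZ haZ t) (by simp [hx, ha])
    simp only [map_add, map_smul, map_sub, smul_eq_mul, hga, add_eq_left, mul_eq_zero] at hgt
    exact sub_eq_zero.1 (hgt.resolve_left ht0.ne')
  refine Set.Subset.antisymm (fun x hx => ⟨hx.1, hsub x hx.1 hx.2⟩) fun x hx => ⟨hx.1, ?_⟩
  by_contra hxc
  obtain ⟨y, hyZ, hy⟩ := hg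
  refine hy ?_
  have hd : f x - c ≠ 0 := sub_ne_zero.2 hxc
  have hz := hsub _ (hZ.add_smul_sub_mem hyZ hx.1 haZ (-((f y - c) / (f x - c)))) (by
    simp only [map_add, map_smul, map_sub, smul_eq_mul, ha]
    field_simp
    ring)
  simpa [hx.2, hga] using hz

theorem EssentialFor.exists_bdIn_eq {m : ℕ} {ι : Type*} [Finite ι] {X Z H : Set (Fin m → ℝ)}
    {f : ι → (Fin m → ℝ) →ₗ[ℝ] ℝ} {c : ι → ℝ}
    (hloc : ∀ x : Fin m → ℝ, (∀ i, (∀ y ∈ Z, f i y = f i x) ∨ f i x ≠ c i) →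
      ∀ᶠ y in 𝓝 x, y ∈ Z → (y ∈ X ↔ x ∈ X))
    (hZ : IsFlat Z) (hH : IsHalfFlatOf Z H) (hess : EssentialFor Z X H) :
    ∃ i, bdIn Z H = {x ∈ Z | f i x = c i} := by
  obtain ⟨hHZ, g, e, hbd⟩ := hH.exists_bdIn_eq hZ
  obtain ⟨a, ha, r, hr, hXH⟩ := hess
  rw [cube_eq_ball a hr] at hXH
  have ha' := ha
  rw [hbd] at ha'
  have hcover : ∀ x ∈ bdIn Z H ∩ Metric.ball a r,
      ∃ i, (∃ y ∈ Z, f i y ≠ c i) ∧ f i x = c i := by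
    rintro x ⟨hx, hxr⟩
    by_contra! hno
    refine not_eventually_mem_iff_of_mem_bdIn hHZ hx (x ∈ X) ?_
    have hx' : ∀ i, (∀ y ∈ Z, f i y = f i x) ∨ f i x ≠ c i := by
      intro i
      by_contra! hi
      obtain ⟨⟨y, hyZ, hy⟩, hi⟩ := hi
      exact hno i ⟨y, hyZ, hi ▸ hy⟩ hi
    filter_upwards [hloc x hx', Metric.isOpen_ball.mem_nhds hxr] with y hy hyr hyZ
    rw [← hy hyZ]
    have := Set.ext_iff.1 hXH y
    simp only [Set.mem_inter_iff, hyr, and_true] at this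
    exact this.symm
  have hconv : Convex ℝ (bdIn Z H ∩ Metric.ball a r) := by
    refine Convex.inter ?_ (convex_ball a r)
    rw [hbd, convex_iff_add_mem]
    intro x hx y hy s t _ _ hst
    obtain rfl : s = 1 - t := by linarith
    refine ⟨?_, by simp [hx.2, hy.2]; ring⟩
    convert hZ.add_smul_sub_mem hx.1 hy.1 hx.1 t using 1
    module
  have := Fintype.ofFinite ι
  obtain ⟨i, hiZ, hi⟩ : ∃ i, (∃ y ∈ Z, f i y ≠ c i) ∧
      ∀ x ∈ bdIn Z H ∩ Metric.ball a r, f i x = c i := by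
    by_contra! hno
    obtain ⟨x, hx, hxi⟩ := hconv.exists_forall_ne ⟨a, ha, Metric.mem_ball_self hr⟩ f c
      {i | ∃ y ∈ Z, f i y ≠ c i} fun i hi => hno i (by simpa using hi)
    obtain ⟨i, hi, hxc⟩ := hcover x hx
    exact hxi i (by simpa using hi) hxc
  refine ⟨i, hbd.trans (hZ.sep_eq_of_eventually ha'.1 ha'.2 ?_ hiZ)⟩
  filter_upwards [Metric.ball_mem_nhds a hr] with x hxr hxZ hxe
  exact hi x ⟨hbd ▸ ⟨hxZ, hxe⟩, hxr⟩

/-- every semilinear `X` whose flat closure is a flat of the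
same dimension admits an essential approximation. -/
theorem exists_essential_approx {m : ℕ} (X : Set (Fin m → ℝ)) (hX : IsSemilinear X)
    (Z : Set (Fin m → ℝ)) (hZ : IsFlat Z) (hfcl : fcl X = Z) (d : ℕ)
    (hdZ : sldim Z = (d : ℤ)) (hdX : sldim X = (d : ℤ)) :
    ∃ (ℓ : ℕ) (H : Fin ℓ → Set (Fin m → ℝ)), IsEssentialApprox Z X H := by
  obtain ⟨ι, _, f, c, hloc⟩ := hX.exists_eventually_mem_iff
  have hfin : (bdIn Z '' {H | IsHalfFlatOf Z H ∧ EssentialFor Z X H}).Finite := by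
    refine (Set.finite_range fun i => {x ∈ Z | f i x = c i}).subset ?_
    rintro _ ⟨H, ⟨hH, hess⟩, rfl⟩
    exact (hess.exists_bdIn_eq (hloc Z) hZ hH).imp fun i hi => hi.symm
  obtain ⟨n, ⟨φ⟩⟩ := hfin.exists_equiv_fin
  choose H hH hbd using fun i => (φ.symm i).2
  refine ⟨n, H, hH, fun H' hH' hess => ?_, fun i j hij h => hij ?_⟩
  · refine ⟨φ ⟨_, H', ⟨hH', hess⟩, rfl⟩, ?_⟩
    rw [hbd, φ.symm_apply_apply]
  · rw [hbd, hbd] at h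
    exact φ.symm.injective (Subtype.ext h)
end
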